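/- Let A, B, P ∈ H₂ satisfy A < B, rank(P − A) ≤ 1, and rank(P − B) ≤ 1. Then: (a) for every X ∈ H₂ with A < X ≤ B such that not both rank(X − P) ≤ 1 and rank(X − B) ≤ 1 hold, there exists Y ∈ H₂ with A ≤ Y ≤ P, Y ≠ A, Y ≠ P, and rank(X − Y) ≤ 1; (b) for every X ∈ H₂ with A ≤ X < B such that not both rank(X − A) ≤ 1 and rank(X − P) ≤ 1 hold, there exists Y ∈ H₂ with P ≤ Y ≤ B, Y ≠ P, Y ≠ B, and rank(X − Y) ≤ 1. -/

import Mathlib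

open Matrix
open scoped ComplexOrder

noncomputable section

/-- The space of `2×2` complex matrices. -/
abbrev Mat2 : Type := Matrix (Fin 2) (Fin 2) ℂ

/-- The group of `2×2` complex unitary matrices. -/
abbrev U2 : Type := Matrix.unitaryGroup (Fin 2) ℂ

/-- Coherency for matrices: `A ∼ B` iff `rank (A − B) ≤ 1`. -/
def Coherent (A B : Mat2) : Prop := (A - B).rank ≤ 1

/-- Coherency for unitaries: `U ∼ V` iff `rank (U − V) ≤ 1`. -/
def CoherentU (U V : U2) : Prop := ((U : Mat2) - (V : Mat2)).rank ≤ 1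

/-- The Cayley transform, as a matrix: `𝔠(A) = (A − iI)(A + iI)⁻¹`. -/
def cayleyMat (A : Mat2) : Mat2 :=
  (A - Complex.I • (1 : Mat2)) * (A + Complex.I • (1 : Mat2))⁻¹

open Classical in
/-- The Cayley transform, landing in the unitary group.  For every hermitian `A` the matrix
`cayleyMat A` is unitary, so the junk value `1` is never used for the matrices considered here. -/
def cayley (A : Mat2) : U2 :=
  if h : cayleyMat A ∈ Matrix.unitaryGroup (Fin 2) ℂ then ⟨cayleyMat A, h⟩ else 1

/-- An automorphism of `U₂`: a bijection preserving coherency in both directions. -/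
def IsAut (Φ : U2 → U2) : Prop :=
  Function.Bijective Φ ∧ ∀ U V : U2, CoherentU U V ↔ CoherentU (Φ U) (Φ V)

/-- A line in `U₂`: a maximal subset all of whose elements are pairwise coherent. -/
def IsLine (ℓ : Set U2) : Prop :=
  (∀ U ∈ ℓ, ∀ V ∈ ℓ, CoherentU U V) ∧
  ∀ m : Set U2, ℓ ⊆ m → (∀ U ∈ m, ∀ V ∈ m, CoherentU U V) → m = ℓ

/-- The matrix interval `[A, B] = {X : A ≤ X ≤ B}` (in the Loewner order). -/
def matIcc (A B : Mat2) : Set Mat2 := {X | (X - A).PosSemidef ∧ (B - X).PosSemidef}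

/-- Rank one projections: `P = P* = P²` of rank one. -/
def IsProj1 (P : Mat2) : Prop := P.IsHermitian ∧ P * P = P ∧ P.rank = 1

/-- A `2×2` complex matrix has rank at most one iff its determinant vanishes. -/
lemma rank_le_one_iff_det_eq_zero (M : Mat2) : M.rank ≤ 1 ↔ M.det = 0 := by
  constructor
  · intro h
    by_contra hd
    have := Matrix.rank_of_det_ne_zero hd
    simp at this
    omega
  · intro h
    obtain ⟨v, hv, hMv⟩ := Matrix.exists_mulVec_eq_zero_iff.mpr h
    have hker : 0 < Module.finrank ℂ (LinearMap.ker M.mulVecLin) :=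
      Module.finrank_pos_iff_exists_ne_zero.mpr
        ⟨⟨v, by simpa using hMv⟩, fun h0 => hv (congrArg Subtype.val h0)⟩
    have hsum := LinearMap.finrank_range_add_finrank_ker M.mulVecLin
    simp only [Module.finrank_fin_fun] at hsum
    unfold Matrix.rank
    omega

lemma rank_sub_le_one_comm (M N : Mat2) : (M - N).rank ≤ 1 ↔ (N - M).rank ≤ 1 := by
  rw [rank_le_one_iff_det_eq_zero, rank_le_one_iff_det_eq_zero, ← neg_sub N M, Matrix.det_neg]
  simp only [Fintype.card_fin, even_two, Even.neg_pow, one_pow, one_mul]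

/-- The determinant of a hermitian matrix is real. -/
lemma Matrix.IsHermitian.exists_det_eq_ofReal {M : Mat2} (hM : M.IsHermitian) :
    ∃ r : ℝ, M.det = (r : ℂ) :=
  ⟨∏ i, hM.eigenvalues i, by rw [hM.det_eq_prod_eigenvalues]; simp⟩

lemma Matrix.IsHermitian.posSemidef_of_det_nonneg_of_trace_nonneg {M : Mat2}
    (hM : M.IsHermitian) (hd : 0 ≤ M.det.re) (ht : 0 ≤ M.trace.re) : M.PosSemidef := by
  rw [hM.posSemidef_iff_eigenvalues_nonneg]
  rw [hM.det_eq_prod_eigenvalues] at hd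
  rw [hM.trace_eq_sum_eigenvalues] at ht
  simp [Fin.prod_univ_two, Fin.sum_univ_two] at hd ht
  intro i
  fin_cases i <;> simp <;> nlinarith

/-- A `2×2` hermitian matrix with nonnegative determinant is semidefinite. -/
lemma Matrix.IsHermitian.posSemidef_or_neg_posSemidef {M : Mat2}
    (hM : M.IsHermitian) (hd : 0 ≤ M.det.re) : M.PosSemidef ∨ (-M).PosSemidef := by
  rcases le_total 0 M.trace.re with ht | ht
  · exact Or.inl (hM.posSemidef_of_det_nonneg_of_trace_nonneg hd ht)
  · refine Or.inr (hM.neg.posSemidef_of_det_nonneg_of_trace_nonneg ?_ ?_)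
    · simpa [Matrix.det_neg] using hd
    · simpa [Matrix.trace_neg] using ht

/-- A `2×2` hermitian matrix with nonnegative determinant which is positive on some vector is
positive semidefinite. -/
lemma Matrix.IsHermitian.posSemidef_of_dotProduct_pos {M : Mat2}
    (hM : M.IsHermitian) (hd : 0 ≤ M.det.re) {u : Fin 2 → ℂ} (hu : 0 < star u ⬝ᵥ M *ᵥ u) :
    M.PosSemidef := by
  refine (hM.posSemidef_or_neg_posSemidef hd).resolve_right fun hneg => ?_
  have h := hneg.dotProduct_mulVec_nonneg u
  rw [Matrix.neg_mulVec, dotProduct_neg] at h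
  exact absurd hu (not_lt_of_ge (neg_nonneg.mp h))

/-- If `Q` and `D - Q` are singular and `D` is positive definite, then `Q` is a nonzero positive
semidefinite matrix. -/
lemma posSemidef_of_det_eq_zero_of_det_sub_eq_zero {Q D : Mat2} (hQ : Q.IsHermitian)
    (hD : D.PosDef) (hQ0 : Q.det = 0) (hDQ : (D - Q).det = 0) : Q.PosSemidef ∧ Q ≠ 0 := by
  obtain ⟨v, hv, hDQv⟩ := Matrix.exists_mulVec_eq_zero_iff.mpr hDQ
  rw [Matrix.sub_mulVec, sub_eq_zero] at hDQv
  have hpos := hD.dotProduct_mulVec_pos hv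
  rw [hDQv] at hpos
  refine ⟨hQ.posSemidef_of_dotProduct_pos (by simp [hQ0]) hpos, ?_⟩
  rintro rfl
  simp at hpos

/-- If `Q` and `D - Q` are singular and `0 < Z ≤ D`, then `Z - Q` is indefinite unless both `Z - Q`
and `D - Z` are singular. -/
lemma det_sub_neg {Z Q D : Mat2} (hQ : Q.IsHermitian) (hQ0 : Q.det = 0)
    (hDQ : (D - Q).det = 0) (hZ : Z.PosDef) (hDZ : (D - Z).PosSemidef)
    (hne : ¬ ((Z - Q).det = 0 ∧ (D - Z).det = 0)) : (Z - Q).det.re < 0 := by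
  by_contra! hdet
  obtain ⟨u, hu, hQu⟩ := Matrix.exists_mulVec_eq_zero_iff.mpr hQ0
  obtain ⟨v, hv, hDQv⟩ := Matrix.exists_mulVec_eq_zero_iff.mpr hDQ
  have hT : (Z - Q).PosSemidef := by
    refine (hZ.1.sub hQ).posSemidef_of_dotProduct_pos hdet (u := u) ?_
    rw [Matrix.sub_mulVec, hQu, sub_zero]
    exact hZ.dotProduct_mulVec_pos hu
  have hsum : star v ⬝ᵥ (Z - Q) *ᵥ v + star v ⬝ᵥ (D - Z) *ᵥ v = 0 := by
    rw [← dotProduct_add, ← Matrix.add_mulVec, add_comm, sub_add_sub_cancel, hDQv,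
      dotProduct_zero]
  obtain ⟨hTv, hWv⟩ := (add_eq_zero_iff_of_nonneg (hT.dotProduct_mulVec_nonneg v)
    (hDZ.dotProduct_mulVec_nonneg v)).mp hsum
  exact hne ⟨Matrix.exists_mulVec_eq_zero_iff.mp ⟨v, hv, (hT.dotProduct_mulVec_zero_iff v).mp hTv⟩,
    Matrix.exists_mulVec_eq_zero_iff.mp ⟨v, hv, (hDZ.dotProduct_mulVec_zero_iff v).mp hWv⟩⟩

/-- For singular `Q`, the determinant is affine along `t ↦ Z - t • Q`. -/
lemma det_sub_smul (Z Q : Mat2) (hQ0 : Q.det = 0) (t : ℂ) :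
    (Z - t • Q).det = Z.det - t * (Z.det - (Z - Q).det) := by
  rw [Matrix.det_fin_two] at hQ0
  simp only [Matrix.det_fin_two, Matrix.sub_apply, Matrix.smul_apply, smul_eq_mul]
  linear_combination (t ^ 2 - t) * hQ0

lemma exists_det_sub_smul_eq_zero {Z Q : Mat2} (hQ : Q.IsHermitian) (hQ0 : Q.det = 0)
    (hZ : Z.PosDef) (hdet : (Z - Q).det.re < 0) :
    ∃ t : ℝ, 0 < t ∧ t < 1 ∧ (Z - (t : ℂ) • Q).det = 0 := by
  obtain ⟨z, hz⟩ := hZ.1.exists_det_eq_ofReal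
  obtain ⟨s, hs⟩ := (hZ.1.sub hQ).exists_det_eq_ofReal
  have hzpos : 0 < z := by
    have := hZ.det_pos
    rw [hz] at this
    exact_mod_cast this
  have hsneg : s < 0 := by simpa [hs] using hdet
  have hzs : 0 < z - s := by linarith
  refine ⟨z / (z - s), div_pos hzpos hzs, (div_lt_one hzs).mpr (by linarith), ?_⟩
  rw [det_sub_smul Z Q hQ0, hz, hs]
  norm_cast
  field_simp
  ring

lemma exists_coherent_lower_half {A B P X : Mat2} (hA : A.IsHermitian) (hP : P.IsHermitian)
    (hAB : (B - A).PosDef) (hPA : (P - A).rank ≤ 1) (hPB : (P - B).rank ≤ 1)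
    (hAX : (X - A).PosDef) (hXB : (B - X).PosSemidef)
    (hX : ¬ ((X - P).rank ≤ 1 ∧ (X - B).rank ≤ 1)) :
    ∃ Y : Mat2, (Y - A).PosSemidef ∧ (P - Y).PosSemidef ∧ Y ≠ A ∧ Y ≠ P ∧
      (X - Y).rank ≤ 1 := by
  have hQ : (P - A).IsHermitian := hP.sub hA
  rw [rank_sub_le_one_comm X B] at hX
  rw [rank_sub_le_one_comm] at hPB
  simp only [rank_le_one_iff_det_eq_zero] at hPA hPB hX ⊢
  have hDQ : ((B - A) - (P - A)).det = 0 := by rwa [sub_sub_sub_cancel_right]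
  obtain ⟨hQpos, hQne⟩ := posSemidef_of_det_eq_zero_of_det_sub_eq_zero hQ hAB hPA hDQ
  have hdet : ((X - A) - (P - A)).det.re < 0 :=
    det_sub_neg hQ hPA hDQ hAX (by rwa [sub_sub_sub_cancel_right])
      (by simpa only [sub_sub_sub_cancel_right] using hX)
  obtain ⟨t, ht0, ht1, ht⟩ := exists_det_sub_smul_eq_zero hQ hPA hAX hdet
  have hcompl : P - (A + (t : ℂ) • (P - A)) = ((1 - t : ℝ) : ℂ) • (P - A) := by
    push_cast
    module
  refine ⟨A + (t : ℂ) • (P - A), ?_, ?_, ?_, ?_, ?_⟩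
  · rw [add_sub_cancel_left]
    exact hQpos.smul (by exact_mod_cast ht0.le)
  · rw [hcompl]
    exact hQpos.smul (by exact_mod_cast sub_nonneg.mpr ht1.le)
  · rw [Ne, add_eq_left]
    exact smul_ne_zero (by exact_mod_cast ht0.ne') hQne
  · intro h
    have h0 := sub_eq_zero.mpr h.symm
    rw [hcompl] at h0
    exact smul_ne_zero (by exact_mod_cast (sub_pos.mpr ht1).ne') hQne h0
  · rwa [← sub_sub]

/-- For `A < B` and `P ∈ 𝒮_{A,B}`: (a) every `X` with `A < X ≤ B` not on the line through `P`
and `B` is coherent to some `Y ∈ [A, P] \ {A, P}`; (b) every `X` with `A ≤ X < B` not on the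
line through `A` and `P` is coherent to some `Y ∈ [P, B] \ {P, B}`. -/
theorem interval_coherent_to_half
    (A B P : Mat2) (hA : A.IsHermitian) (hB : B.IsHermitian) (hP : P.IsHermitian)
    (hAB : (B - A).PosDef)
    (hPA : (P - A).rank ≤ 1) (hPB : (P - B).rank ≤ 1) :
    (∀ X : Mat2, (X - A).PosDef → (B - X).PosSemidef →
      ¬ ((X - P).rank ≤ 1 ∧ (X - B).rank ≤ 1) →
      ∃ Y : Mat2, (Y - A).PosSemidef ∧ (P - Y).PosSemidef ∧ Y ≠ A ∧ Y ≠ P ∧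
        (X - Y).rank ≤ 1) ∧
    (∀ X : Mat2, (X - A).PosSemidef → (B - X).PosDef →
      ¬ ((X - A).rank ≤ 1 ∧ (X - P).rank ≤ 1) →
      ∃ Y : Mat2, (Y - P).PosSemidef ∧ (B - Y).PosSemidef ∧ Y ≠ P ∧ Y ≠ B ∧
        (X - Y).rank ≤ 1) := by
  refine ⟨fun X hAX hXB hX => exists_coherent_lower_half hA hP hAB hPA hPB hAX hXB hX,
    fun X hAX hXB hX => ?_⟩
  obtain ⟨Y, hBY, hYP, hYB, hYP', hXY⟩ := exists_coherent_lower_half (A := -B) (B := -A) (P := -P)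
    (X := -X) hB.neg hP.neg (by rwa [neg_sub_neg]) (by rwa [neg_sub_neg, rank_sub_le_one_comm])
    (by rwa [neg_sub_neg, rank_sub_le_one_comm]) (by rwa [neg_sub_neg]) (by rwa [neg_sub_neg])
    (by rwa [neg_sub_neg, neg_sub_neg, rank_sub_le_one_comm P, rank_sub_le_one_comm A, and_comm])
  refine ⟨-Y, ?_, ?_, fun h => hYP' (neg_eq_iff_eq_neg.mp h), fun h => hYB (neg_eq_iff_eq_neg.mp h),
    ?_⟩
  · rwa [neg_sub_comm]
  · rwa [sub_neg_eq_add, add_comm, ← sub_neg_eq_add]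
  · rw [rank_sub_le_one_comm]
    rwa [neg_sub_comm]
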